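/- Let G_n be an inhomogeneous random graph with type dependence on n vertices, and suppose the map F ↦ g^{[F]} is continuous from M([0,1]) with the weak topology to the space of graphons with the L¹-norm. Then for every ε > 0, limsup_{n→∞} (1/(n(n−1)/2)) log P( δ_□(h^{G_n}, g^{[F_n]}) ≥ ε ) ≤ − ε². -/

import Mathlib

open MeasureTheory Filter
open scoped ENNReal

noncomputable section

/-- The unit square `[0,1]² ⊆ ℝ²`. -/
def unitSq : Set (ℝ × ℝ) := Set.Icc (0:ℝ) 1 ×ˢ Set.Icc (0:ℝ) 1

/-- A graphon: a symmetric measurable function `[0,1]² → [0,1]` (extended to `ℝ²`). -/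
def IsGraphon (h : ℝ → ℝ → ℝ) : Prop :=
  Measurable (Function.uncurry h) ∧ (∀ x y, h x y = h y x) ∧ ∀ x y, h x y ∈ Set.Icc (0:ℝ) 1

def GraphonSet : Set (ℝ → ℝ → ℝ) := {h | IsGraphon h}

/-- The cut distance `d_□`. -/
def cutDist (h₁ h₂ : ℝ → ℝ → ℝ) : ℝ :=
  ⨆ S : {S : Set ℝ // MeasurableSet S ∧ S ⊆ Set.Icc 0 1},
    ⨆ T : {T : Set ℝ // MeasurableSet T ∧ T ⊆ Set.Icc 0 1},
      |∫ p in S.1 ×ˢ T.1, (h₁ p.1 p.2 - h₂ p.1 p.2)|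

/-- A measure-preserving bijection of `[0,1]`. -/
structure MPBij where
  toFun : ℝ → ℝ
  bijOn : Set.BijOn toFun (Set.Icc 0 1) (Set.Icc 0 1)
  mp : MeasurePreserving toFun (volume.restrict (Set.Icc 0 1)) (volume.restrict (Set.Icc 0 1))

instance : Nonempty MPBij := ⟨⟨id, Set.bijOn_id _, MeasurePreserving.id _⟩⟩

/-- Relabelling of a graphon: `h^σ(x,y) = h(σ x, σ y)`. -/
def relabel (σ : MPBij) (h : ℝ → ℝ → ℝ) : ℝ → ℝ → ℝ := fun x y => h (σ.toFun x) (σ.toFun y)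

/-- The cut metric `δ_□`. -/
def cutMetric (h₁ h₂ : ℝ → ℝ → ℝ) : ℝ :=
  ⨅ σ₁ : MPBij, ⨅ σ₂ : MPBij, cutDist (relabel σ₁ h₁) (relabel σ₂ h₂)

/-- `L¹` distance of (graphon-type) kernels over the unit square. -/
def L1dist (h₁ h₂ : ℝ → ℝ → ℝ) : ℝ := ∫ p in unitSq, |h₁ p.1 p.2 - h₂ p.1 p.2|

/-- Bernoulli relative entropy `R(a|b)`, with the conventions `0 log 0 = 0`,
`R(a|0) = ∞` for `a > 0`, `R(a|1) = ∞` for `a < 1`. -/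
def relEnt (a b : ℝ) : ℝ≥0∞ :=
  if b ≤ 0 then (if a ≤ 0 then 0 else ∞)
  else if 1 ≤ b then (if 1 ≤ a then 0 else ∞)
  else ENNReal.ofReal (a * Real.log (a / b) + (1 - a) * Real.log ((1 - a) / (1 - b)))

/-- The rate function `I_r(h) = ∫_{[0,1]²} R(h(x,y)|r(x,y)) dx dy`. -/
def Irate (r h : ℝ → ℝ → ℝ) : ℝ≥0∞ := ∫⁻ p in unitSq, relEnt (h p.1 p.2) (r p.1 p.2)

/-- `Ĩ_r(h̃) = inf_σ I_r(h^σ)`. -/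
def IrateTilde (r h : ℝ → ℝ → ℝ) : ℝ≥0∞ := ⨅ σ : MPBij, Irate r (relabel σ h)

/-- Closed subsets of graphon space for the (pseudo)metric `δ_□`; these correspond exactly to
the closed subsets of the quotient space `(W̃, δ_□)`. -/
def DeltaClosedIn (C : Set (ℝ → ℝ → ℝ)) : Prop :=
  C ⊆ GraphonSet ∧ ∀ h ∈ GraphonSet, h ∉ C → ∃ ε > 0, ∀ g ∈ GraphonSet, cutMetric g h < ε → g ∉ C

/-- Open subsets of graphon space for the (pseudo)metric `δ_□`; these correspond exactly to
the open subsets of the quotient space `(W̃, δ_□)`. -/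
def DeltaOpenIn (O : Set (ℝ → ℝ → ℝ)) : Prop :=
  O ⊆ GraphonSet ∧ ∀ h ∈ O, ∃ ε > 0, ∀ g ∈ GraphonSet, cutMetric g h < ε → g ∈ O

/-- `M([0,1])`: Borel probability measures on `[0,1]` with the topology of weak convergence. -/
abbrev M01 := ProbabilityMeasure ↥(Set.Icc (0:ℝ) 1)

/-- empirical measure of a type vector -/
def empMeasAux {n : ℕ} (x : Fin n → ↥(Set.Icc (0:ℝ) 1)) : Measure ↥(Set.Icc (0:ℝ) 1) :=
  (n : ℝ≥0∞)⁻¹ • ∑ i : Fin n, Measure.dirac (x i)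

lemma empMeasAux_isProb {n : ℕ} (hn : n ≠ 0) (x : Fin n → ↥(Set.Icc (0:ℝ) 1)) :
    IsProbabilityMeasure (empMeasAux x) := by
  constructor
  simp only [empMeasAux, Measure.smul_apply, Measure.coe_finset_sum, Finset.sum_apply,
    measure_univ, Finset.sum_const, Finset.card_univ, Fintype.card_fin, nsmul_eq_mul, mul_one,
    smul_eq_mul]
  exact ENNReal.inv_mul_cancel (by exact_mod_cast hn) (by simp)

/-- The empirical type distribution `F_n` as an element of `M([0,1])`. -/
def empMeas {n : ℕ} (x : Fin n → ↥(Set.Icc (0:ℝ) 1)) : M01 :=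
  if h : n = 0 then ⟨Measure.dirac ⟨0, Set.left_mem_Icc.mpr zero_le_one⟩, inferInstance⟩
  else ⟨empMeasAux x, empMeasAux_isProb h x⟩

/-- The cumulative distribution function of `F ∈ M([0,1])`. -/
def cdfM (F : M01) (x : ℝ) : ℝ :=
  ((F : Measure ↥(Set.Icc (0:ℝ) 1)) {t | (t : ℝ) ≤ x}).toReal

/-- The right-continuous generalised inverse `F̄(u) = inf{x ∈ [0,1] : F(x) > u}`. -/
def geninv (F : M01) (u : ℝ) : ℝ := sInf {x | x ∈ Set.Icc (0:ℝ) 1 ∧ u < cdfM F x}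

/-- The induced reference graphon `g^{[F]}(x,y) = H(F̄(x), F̄(y), F)`. -/
def inducedGraphon (Hfun : ℝ → ℝ → M01 → ℝ) (F : M01) : ℝ → ℝ → ℝ :=
  fun x y => Hfun (geninv F x) (geninv F y) F

/-- The vertex `⌈n x⌉` containing the point `x`. -/
def vertexOf (n : ℕ) (x : ℝ) : ℕ := (⌈(n : ℝ) * x⌉).toNat

open Classical in
/-- The empirical graphon of the graph on `[n]` with adjacency relation `A`. -/
def empGraphon {n : ℕ} (A : Fin n → Fin n → Prop) : ℝ → ℝ → ℝ :=
  fun x y =>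
    if h : vertexOf n x - 1 < n ∧ vertexOf n y - 1 < n then
      (if A ⟨vertexOf n x - 1, h.1⟩ ⟨vertexOf n y - 1, h.2⟩ then 1 else 0)
    else 0

/-- Adjacency of the IRGT: given the types `x` and i.i.d. uniforms `u`, the edge `ij` is
active iff `u_{ij} ≤ H(X_i, X_j, F_n)`. -/
def irgtAdj (Hfun : ℝ → ℝ → M01 → ℝ) {n : ℕ} (x : Fin n → ↥(Set.Icc (0:ℝ) 1))
    (u : Fin n × Fin n → ℝ) (i j : Fin n) : Prop :=
  i ≠ j ∧ u (min i j, max i j) ≤ Hfun (x i : ℝ) (x j : ℝ) (empMeas x)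

/-- Adjacency of the inhomogeneous Erdős–Rényi graph with reference graphon `r`: the edge `ij`
(`i,j ∈ {1,…,n}`) is active iff `u_{ij} ≤ r(i/n, j/n)`. -/
def erAdj (r : ℝ → ℝ → ℝ) {n : ℕ} (u : Fin n × Fin n → ℝ) (i j : Fin n) : Prop :=
  i ≠ j ∧ u (min i j, max i j) ≤ r (((i : ℕ) + 1 : ℝ) / n) (((j : ℕ) + 1 : ℝ) / n)

/-- i.i.d. uniforms on `[0,1]`, one for each (potential) edge. -/
def cubeMeasure (n : ℕ) : Measure (Fin n × Fin n → ℝ) :=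
  Measure.pi fun _ => volume.restrict (Set.Icc 0 1)

/-- `n(n-1)/2` as a real-valued rate. -/
def binom2 (n : ℕ) : ℝ := (n : ℝ) * ((n : ℝ) - 1) / 2

/-- The large deviation principle, with speed `a` and rate function `R`, for the laws of the
random elements `f n` (defined on the probability spaces `(Ω n, μ n)`) of a topological space. -/
def SatisfiesLDP {Λ : Type*} [TopologicalSpace Λ] {Ω : ℕ → Type*} [∀ n, MeasurableSpace (Ω n)]
    (μ : ∀ n, Measure (Ω n)) (f : ∀ n, Ω n → Λ) (a : ℕ → ℝ) (R : Λ → ℝ≥0∞) : Prop :=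
  Tendsto a atTop atTop ∧
  (∀ C : Set Λ, IsClosed C →
    atTop.limsup (fun n => (((a n)⁻¹ : ℝ) : EReal) * ENNReal.log (μ n (f n ⁻¹' C)))
      ≤ -(⨅ x ∈ C, (R x : EReal))) ∧
  (∀ O : Set Λ, IsOpen O →
    -(⨅ x ∈ O, (R x : EReal)) ≤
      atTop.liminf (fun n => (((a n)⁻¹ : ℝ) : EReal) * ENNReal.log (μ n (f n ⁻¹' O))))

/-- The large deviation principle on `(W̃, δ_□)`, with speed `a` and rate function `R`, for the
laws of the equivalence classes of the graphon-valued random elements `f n`. -/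
def GraphonLDP {Ω : ℕ → Type*} [∀ n, MeasurableSpace (Ω n)]
    (μ : ∀ n, Measure (Ω n)) (f : ∀ n, Ω n → (ℝ → ℝ → ℝ)) (a : ℕ → ℝ)
    (R : (ℝ → ℝ → ℝ) → ℝ≥0∞) : Prop :=
  Tendsto a atTop atTop ∧
  (∀ C : Set (ℝ → ℝ → ℝ), DeltaClosedIn C →
    atTop.limsup (fun n => (((a n)⁻¹ : ℝ) : EReal) * ENNReal.log (μ n (f n ⁻¹' C)))
      ≤ -(⨅ h ∈ C, (R h : EReal))) ∧
  (∀ O : Set (ℝ → ℝ → ℝ), DeltaOpenIn O →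
    -(⨅ h ∈ O, (R h : EReal)) ≤
      atTop.liminf (fun n => (((a n)⁻¹ : ℝ) : EReal) * ENNReal.log (μ n (f n ⁻¹' O))))

end

/-- The open grid cell `(k/n, (k+1)/n)`. -/
def openCell (n : ℕ) (k : Fin n) : Set ℝ := Set.Ioo ((k : ℝ) / n) (((k : ℝ) + 1) / n)

/-- The half-open grid cell `(k/n, (k+1)/n]`. -/
def halfCell (n : ℕ) (k : Fin n) : Set ℝ := Set.Ioc ((k : ℝ) / n) (((k : ℝ) + 1) / n)

lemma openCell_subset_halfCell {n : ℕ} (k : Fin n) : openCell n k ⊆ halfCell n k :=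
  Set.Ioo_subset_Ioc_self

lemma mem_halfCell_iff {n : ℕ} (k : Fin n) (x : ℝ) :
    x ∈ halfCell n k ↔ vertexOf n x = k + 1 := by
  have hn : (0 : ℝ) < n := by exact_mod_cast k.pos
  have h : vertexOf n x = k + 1 ↔ ⌈(n : ℝ) * x⌉ = ((k : ℕ) : ℤ) + 1 := by
    unfold vertexOf; omega
  rw [h, Int.ceil_eq_iff, halfCell, Set.mem_Ioc, div_lt_iff₀ hn, le_div_iff₀ hn]
  push_cast
  simp [mul_comm]

lemma iUnion_halfCell {n : ℕ} (hn : 0 < n) : ⋃ k, halfCell n k = Set.Ioc (0 : ℝ) 1 := by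
  have hn' : (0 : ℝ) < n := by exact_mod_cast hn
  ext x
  simp only [Set.mem_iUnion, mem_halfCell_iff, Set.mem_Ioc]
  have h0 : 0 < x ↔ 0 < vertexOf n x := by
    unfold vertexOf
    rw [Int.lt_toNat, Nat.cast_zero, Int.ceil_pos]
    exact (mul_pos_iff_of_pos_left hn').symm
  have h1 : x ≤ 1 ↔ vertexOf n x ≤ n := by
    unfold vertexOf
    rw [Int.toNat_le, Int.ceil_le]
    push_cast
    exact ⟨fun h => by nlinarith, fun h => by nlinarith⟩
  rw [h0, h1]
  constructor
  · rintro ⟨k, hk⟩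
    have := k.2
    omega
  · rintro ⟨h0, h1⟩
    exact ⟨⟨vertexOf n x - 1, by omega⟩, by simp only; omega⟩

lemma pairwise_disjoint_halfCell (n : ℕ) :
    Pairwise (Function.onFun Disjoint (halfCell n)) := by
  intro k l hkl
  rw [Function.onFun, Set.disjoint_left]
  intro x hk hl
  rw [mem_halfCell_iff] at hk hl
  exact hkl (Fin.ext (by omega))

lemma ae_mem_openCell {n : ℕ} (hn : 0 < n) :
    ∀ᵐ x : ℝ, x ∈ Set.Icc (0 : ℝ) 1 → ∃ k, x ∈ openCell n k := by
  have hc : (Set.range fun k : ℕ => (k : ℝ) / n).Countable := Set.countable_range _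
  filter_upwards [hc.ae_notMem volume] with x hx hx01
  have h0 : x ≠ 0 := fun h => hx ⟨0, by simp [h]⟩
  have hx' : x ∈ ⋃ k, halfCell n k := by
    rw [iUnion_halfCell hn]
    exact ⟨lt_of_le_of_ne hx01.1 h0.symm, hx01.2⟩
  obtain ⟨k, hk⟩ := Set.mem_iUnion.1 hx'
  refine ⟨k, hk.1, lt_of_le_of_ne hk.2 fun h => hx ⟨k + 1, ?_⟩⟩
  simp [h]

/-- The translation amount, indexed by vertex, that permutes the grid cells. -/
noncomputable def cellShift {n : ℕ} (π : Equiv.Perm (Fin n)) (v : ℕ) : ℝ :=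
  if h : 0 < v ∧ v - 1 < n then (((π ⟨v - 1, h.2⟩ : ℕ) : ℝ) - ((v - 1 : ℕ) : ℝ)) / n else 0

/-- The piecewise translation of the line that permutes the grid cells by `π`. -/
noncomputable def cellPerm {n : ℕ} (π : Equiv.Perm (Fin n)) (x : ℝ) : ℝ := x + cellShift π (vertexOf n x)

lemma cellPerm_eq {n : ℕ} (π : Equiv.Perm (Fin n)) {k : Fin n} {x : ℝ} (hx : x ∈ halfCell n k) :
    cellPerm π x = x + ((π k : ℝ) - k) / n := by
  rw [mem_halfCell_iff] at hx
  simp [cellPerm, cellShift, hx]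

lemma cellPerm_zero {n : ℕ} (π : Equiv.Perm (Fin n)) : cellPerm π 0 = 0 := by
  simp [cellPerm, cellShift, vertexOf]

lemma preimage_add_halfCell {n : ℕ} (k l : Fin n) :
    (fun x : ℝ => x + ((l : ℝ) - k) / n) ⁻¹' halfCell n l = halfCell n k := by
  ext x
  simp only [halfCell, Set.mem_preimage, Set.mem_Ioc, sub_div, add_div]
  constructor <;> rintro ⟨h1, h2⟩ <;> constructor <;> linarith

lemma cellPerm_mem_halfCell {n : ℕ} (π : Equiv.Perm (Fin n)) {k : Fin n} {x : ℝ}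
    (hx : x ∈ halfCell n k) : cellPerm π x ∈ halfCell n (π k) := by
  rw [cellPerm_eq π hx]
  rwa [← preimage_add_halfCell k (π k)] at hx

lemma eq_zero_or_mem_halfCell {n : ℕ} (hn : 0 < n) {x : ℝ} (hx : x ∈ Set.Icc (0 : ℝ) 1) :
    x = 0 ∨ ∃ k, x ∈ halfCell n k := by
  rcases eq_or_lt_of_le hx.1 with h | h
  · exact Or.inl h.symm
  · exact Or.inr (Set.mem_iUnion.1 (by rw [iUnion_halfCell hn]; exact ⟨h, hx.2⟩))

lemma cellPerm_mapsTo {n : ℕ} (hn : 0 < n) (π : Equiv.Perm (Fin n)) :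
    Set.MapsTo (cellPerm π) (Set.Icc 0 1) (Set.Icc 0 1) := by
  intro x hx
  rcases eq_zero_or_mem_halfCell hn hx with rfl | ⟨k, hk⟩
  · rwa [cellPerm_zero]
  · have : cellPerm π x ∈ ⋃ k, halfCell n k :=
      Set.mem_iUnion.2 ⟨_, cellPerm_mem_halfCell π hk⟩
    rw [iUnion_halfCell hn] at this
    exact Set.Ioc_subset_Icc_self this

lemma cellPerm_symm_leftInvOn {n : ℕ} (hn : 0 < n) (π : Equiv.Perm (Fin n)) :
    Set.LeftInvOn (cellPerm π.symm) (cellPerm π) (Set.Icc 0 1) := by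
  intro x hx
  rcases eq_zero_or_mem_halfCell hn hx with rfl | ⟨k, hk⟩
  · simp [cellPerm_zero]
  · rw [cellPerm_eq _ (cellPerm_mem_halfCell π hk), cellPerm_eq π hk, Equiv.symm_apply_apply]
    ring

lemma measurable_cellPerm {n : ℕ} (π : Equiv.Perm (Fin n)) : Measurable (cellPerm π) := by
  have h : Measurable (vertexOf n) := by
    unfold vertexOf
    exact (measurable_of_countable Int.toNat).comp (Int.measurable_ceil.comp (by fun_prop))
  exact measurable_id.add ((measurable_of_countable (cellShift π)).comp h)

lemma measurePreserving_cellPerm {n : ℕ} (hn : 0 < n) (π : Equiv.Perm (Fin n)) :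
    MeasurePreserving (cellPerm π) (volume.restrict (Set.Icc 0 1))
      (volume.restrict (Set.Icc 0 1)) := by
  refine ⟨measurable_cellPerm π, ?_⟩
  have hm : ∀ k, MeasurableSet (halfCell n k) := fun k => measurableSet_Ioc
  have hpiece : ∀ k, Measure.map (cellPerm π) (volume.restrict (halfCell n k))
      = volume.restrict (halfCell n (π k)) := by
    intro k
    have h1 : cellPerm π =ᵐ[volume.restrict (halfCell n k)]
        fun x : ℝ => x + ((π k : ℝ) - k) / n :=
      (ae_restrict_mem (hm k)).mono fun x hx => cellPerm_eq π hx
    rw [Measure.map_congr h1, ← preimage_add_halfCell k (π k)]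
    exact ((measurePreserving_add_right volume _).restrict_preimage (hm _)).map_eq
  rw [← Measure.restrict_congr_set (Ioc_ae_eq_Icc (a := (0 : ℝ)) (b := 1) (μ := volume)),
    ← iUnion_halfCell hn, Measure.restrict_iUnion (pairwise_disjoint_halfCell n) hm,
    Measure.map_sum (measurable_cellPerm π).aemeasurable]
  simp_rw [hpiece]
  exact Measure.sum_comp_equiv π fun k => volume.restrict (halfCell n k)

/-- The measure-preserving bijection of `[0,1]` that permutes the grid cells by `π`. -/
noncomputable def cellMPBij {n : ℕ} (hn : 0 < n) (π : Equiv.Perm (Fin n)) : MPBij where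
  toFun := cellPerm π
  bijOn := Set.InvOn.bijOn
    ⟨cellPerm_symm_leftInvOn hn π, by
      simpa using cellPerm_symm_leftInvOn hn π.symm⟩
    (cellPerm_mapsTo hn π) (cellPerm_mapsTo hn π.symm)
  mp := measurePreserving_cellPerm hn π

open Classical in
lemma empGraphon_of_mem {n : ℕ} (A : Fin n → Fin n → Prop) {k l : Fin n} {x y : ℝ}
    (hx : x ∈ halfCell n k) (hy : y ∈ halfCell n l) :
    empGraphon A x y = if A k l then 1 else 0 := by
  rw [mem_halfCell_iff] at hx hy
  simp [empGraphon, hx, hy]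

lemma abs_sum_mul_le_of_abs_sum_le {ι : Type*} [Fintype ι] (d : ι → ι → ℝ) (M : ℝ)
    (hM : ∀ S T : Finset ι, |∑ i ∈ S, ∑ j ∈ T, d i j| ≤ M) (s t : ι → ℝ)
    (hs : ∀ i, s i ∈ Set.Icc (0 : ℝ) 1) (ht : ∀ i, t i ∈ Set.Icc (0 : ℝ) 1) :
    |∑ i, ∑ j, d i j * (s i * t j)| ≤ M := by
  classical
  have lin : ∀ (a r : ι → ℝ), (∀ i, r i ∈ Set.Icc (0 : ℝ) 1) →
      ∃ S : Finset ι, ∑ i, r i * a i ≤ ∑ i ∈ S, a i := by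
    intro a r hr
    refine ⟨Finset.univ.filter fun i => 0 ≤ a i, ?_⟩
    rw [Finset.sum_filter]
    refine Finset.sum_le_sum fun i _ => ?_
    split_ifs with h
    · exact mul_le_of_le_one_left h (hr i).2
    · exact mul_nonpos_of_nonneg_of_nonpos (hr i).1 (not_le.1 h).le
  have bil : ∀ e : ι → ι → ℝ, ∃ S T : Finset ι,
      ∑ i, ∑ j, e i j * (s i * t j) ≤ ∑ i ∈ S, ∑ j ∈ T, e i j := by
    intro e
    obtain ⟨S, hS⟩ := lin (fun i => ∑ j, e i j * t j) s hs
    obtain ⟨T, hT⟩ := lin (fun j => ∑ i ∈ S, e i j) t ht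
    refine ⟨S, T, ?_⟩
    calc ∑ i, ∑ j, e i j * (s i * t j) = ∑ i, s i * ∑ j, e i j * t j := by
          refine Finset.sum_congr rfl fun i _ => ?_
          rw [Finset.mul_sum]
          exact Finset.sum_congr rfl fun j _ => by ring
      _ ≤ ∑ i ∈ S, ∑ j, e i j * t j := hS
      _ = ∑ j, t j * ∑ i ∈ S, e i j := by
          rw [Finset.sum_comm]
          refine Finset.sum_congr rfl fun j _ => ?_
          rw [Finset.mul_sum]
          exact Finset.sum_congr rfl fun i _ => by ring
      _ ≤ ∑ j ∈ T, ∑ i ∈ S, e i j := hT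
      _ = _ := Finset.sum_comm
  rw [abs_le]
  constructor
  · obtain ⟨S, T, h⟩ := bil fun i j => -d i j
    have := (abs_le.1 (hM S T)).1
    simp only [neg_mul, Finset.sum_neg_distrib] at h
    linarith
  · obtain ⟨S, T, h⟩ := bil d
    exact h.trans ((le_abs_self _).trans (hM S T))

lemma cutDist_le_of_step {n : ℕ} (hn : 0 < n) (h₁ h₂ : ℝ → ℝ → ℝ) (d : Fin n → Fin n → ℝ) (M : ℝ)
    (hd : ∀ k l, ∀ x ∈ openCell n k, ∀ y ∈ openCell n l, h₁ x y - h₂ x y = d k l)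
    (hM : ∀ S T : Finset (Fin n), |∑ i ∈ S, ∑ j ∈ T, d i j| ≤ M) :
    cutDist h₁ h₂ ≤ M / (n : ℝ) ^ 2 := by
  have hn' : (0 : ℝ) < n := by exact_mod_cast hn
  have hM0 : 0 ≤ M := (abs_nonneg _).trans (hM ∅ ∅)
  refine Real.iSup_le (fun S => Real.iSup_le (fun T => ?_) (by positivity)) (by positivity)
  obtain ⟨S, hS, hS1⟩ := S
  obtain ⟨T, hT, hT1⟩ := T
  simp only
  set J : Fin n → ℝ → ℝ := fun k => (openCell n k).indicator 1 with hJ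
  have hJm : ∀ k, MeasurableSet (openCell n k) := fun k => measurableSet_Ioo
  have hdisj : ∀ k l x, x ∈ openCell n k → J l x = if l = k then 1 else 0 := by
    intro k l x hx
    split_ifs with h
    · subst h; simp [hJ, hx]
    · refine Set.indicator_of_notMem (fun hl => ?_) _
      exact Set.disjoint_left.1 (pairwise_disjoint_halfCell n h)
        (openCell_subset_halfCell _ hl) (openCell_subset_halfCell _ hx)
  have hvol : ∀ (U : Set ℝ) (k : Fin n), (n : ℝ) * ∫ x in U, J k x ∈ Set.Icc (0 : ℝ) 1 := by
    intro U k
    have h1 : ∫ x in U, J k x = volume.real (openCell n k ∩ U) := by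
      rw [hJ]
      simp only
      rw [integral_indicator_one (hJm k), measureReal_restrict_apply (hJm k)]
    have h2 : volume.real (openCell n k) = 1 / n := by
      rw [openCell, Real.volume_real_Ioo_of_le (by gcongr; linarith)]
      ring
    have h3 : volume.real (openCell n k ∩ U) ≤ 1 / n := by
      rw [← h2]
      exact measureReal_mono Set.inter_subset_left (by simp [openCell])
    rw [h1]
    refine ⟨by positivity, ?_⟩
    calc (n : ℝ) * volume.real (openCell n k ∩ U) ≤ n * (1 / n) := by gcongr
      _ = 1 := by field_simp
  have hae : ∀ᵐ p ∂(volume : Measure (ℝ × ℝ)).restrict (S ×ˢ T),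
      h₁ p.1 p.2 - h₂ p.1 p.2 = ∑ k, ∑ l, d k l * (J k p.1 * J l p.2) := by
    rw [Measure.volume_eq_prod]
    have a1 := Measure.quasiMeasurePreserving_fst (μ := (volume : Measure ℝ))
      (ν := (volume : Measure ℝ)) |>.ae (ae_mem_openCell hn)
    have a2 := Measure.quasiMeasurePreserving_snd (μ := (volume : Measure ℝ))
      (ν := (volume : Measure ℝ)) |>.ae (ae_mem_openCell hn)
    filter_upwards [ae_restrict_of_ae a1, ae_restrict_of_ae a2,
      ae_restrict_mem (hS.prod hT)] with p hp1 hp2 hp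
    obtain ⟨k, hk⟩ := hp1 (hS1 hp.1)
    obtain ⟨l, hl⟩ := hp2 (hT1 hp.2)
    rw [hd k l _ hk _ hl]
    simp [hdisj _ _ _ hk, hdisj _ _ _ hl]
  have hfin : ∀ U : Set ℝ, U ⊆ Set.Icc 0 1 → IsFiniteMeasure (volume.restrict U) := by
    intro U hU
    refine ⟨?_⟩
    rw [Measure.restrict_apply_univ]
    exact (measure_mono hU).trans_lt (by simp)
  have hJi : ∀ U : Set ℝ, U ⊆ Set.Icc 0 1 → ∀ k, Integrable (J k) (volume.restrict U) := by
    intro U hU k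
    have := hfin U hU
    exact (integrable_const (1 : ℝ)).indicator (hJm k)
  have hint : ∫ p in S ×ˢ T, (h₁ p.1 p.2 - h₂ p.1 p.2)
      = ∑ k, ∑ l, d k l * ((∫ x in S, J k x) * ∫ y in T, J l y) := by
    rw [integral_congr_ae hae]
    have hI : ∀ k l, Integrable (fun p : ℝ × ℝ => d k l * (J k p.1 * J l p.2))
        ((volume : Measure (ℝ × ℝ)).restrict (S ×ˢ T)) := by
      intro k l
      rw [Measure.volume_eq_prod, ← Measure.prod_restrict]
      have := hfin S hS1
      have := hfin T hT1
      exact ((hJi S hS1 k).mul_prod (hJi T hT1 l)).const_mul _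
    rw [integral_finsetSum _ fun k _ => integrable_finsetSum _ fun l _ => hI k l]
    refine Finset.sum_congr rfl fun k _ => ?_
    rw [integral_finsetSum _ fun l _ => hI k l]
    refine Finset.sum_congr rfl fun l _ => ?_
    rw [integral_const_mul, Measure.volume_eq_prod, setIntegral_prod_mul]
  rw [hint, le_div_iff₀ (by positivity)]
  have key := abs_sum_mul_le_of_abs_sum_le d M hM _ _ (hvol S) (hvol T)
  refine le_trans (le_of_eq ?_) key
  rw [← abs_of_pos (pow_pos hn' 2), ← abs_mul, Finset.sum_mul]
  congr 1
  refine Finset.sum_congr rfl fun k _ => ?_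
  rw [Finset.sum_mul]
  exact Finset.sum_congr rfl fun l _ => by ring

lemma cutDist_nonneg (h₁ h₂ : ℝ → ℝ → ℝ) : 0 ≤ cutDist h₁ h₂ :=
  Real.iSup_nonneg fun _ => Real.iSup_nonneg fun _ => abs_nonneg _

lemma cutMetric_le_cutDist (h₁ h₂ : ℝ → ℝ → ℝ) (σ : MPBij) :
    cutMetric h₁ h₂ ≤ cutDist (relabel σ h₁) h₂ := by
  have hb : ∀ σ₁, BddBelow (Set.range fun σ₂ => cutDist (relabel σ₁ h₁) (relabel σ₂ h₂)) :=
    fun σ₁ => ⟨0, by rintro _ ⟨σ₂, rfl⟩; exact cutDist_nonneg _ _⟩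
  refine (ciInf_le ⟨0, ?_⟩ σ).trans
    (ciInf_le (hb σ) ⟨id, Set.bijOn_id _, MeasurePreserving.id _⟩)
  rintro _ ⟨σ₁, rfl⟩
  exact Real.iInf_nonneg fun _ => cutDist_nonneg _ _

lemma card_filter_le_of_sort {n : ℕ} (x : Fin n → ↥(Set.Icc (0:ℝ) 1)) (k : Fin n) (t : ℝ) :
    (k : ℕ) < (Finset.univ.filter fun i => (x i : ℝ) ≤ t).card ↔ (x (Tuple.sort x k) : ℝ) ≤ t := by
  have hmono : Monotone (x ∘ Tuple.sort x) := Tuple.monotone_sort x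
  have hcard : (Finset.univ.filter fun i => (x i : ℝ) ≤ t).card
      = (Finset.univ.filter fun j => (x (Tuple.sort x j) : ℝ) ≤ t).card := by
    refine (Finset.card_bij (fun j _ => Tuple.sort x j) ?_ ?_ ?_).symm
    · intro j hj; simpa using hj
    · intro a _ b _ h; exact (Tuple.sort x).injective h
    · intro b hb; exact ⟨(Tuple.sort x).symm b, by simpa using hb, by simp⟩
  rw [hcard]
  constructor
  · intro h
    by_contra hlt
    refine absurd h (not_lt.2 ?_)
    rw [← Fin.card_Iio k]
    refine Finset.card_le_card fun j hj => ?_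
    rw [Finset.mem_Iio]
    by_contra hkj
    have h1 : x (Tuple.sort x k) ≤ x (Tuple.sort x j) := hmono (not_lt.1 hkj)
    have h2 : (x (Tuple.sort x j) : ℝ) ≤ t := (Finset.mem_filter.1 hj).2
    exact hlt (le_trans (by exact_mod_cast h1) h2)
  · intro h
    rw [← Nat.succ_le_iff, Nat.succ_eq_add_one, ← Fin.card_Iic k]
    refine Finset.card_le_card fun j hj => ?_
    have h1 : x (Tuple.sort x j) ≤ x (Tuple.sort x k) := hmono (Finset.mem_Iic.1 hj)
    have h2 : (x (Tuple.sort x j) : ℝ) ≤ x (Tuple.sort x k) := by exact_mod_cast h1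
    simpa using h2.trans h

lemma coe_empMeas {n : ℕ} (hn : 0 < n) (x : Fin n → ↥(Set.Icc (0:ℝ) 1)) :
    (empMeas x : Measure ↥(Set.Icc (0:ℝ) 1)) = empMeasAux x := by
  have h : empMeas x = ⟨empMeasAux x, empMeasAux_isProb hn.ne' x⟩ := dif_neg hn.ne'
  rw [h]
  rfl

lemma cdfM_empMeas {n : ℕ} (hn : 0 < n) (x : Fin n → ↥(Set.Icc (0:ℝ) 1)) (t : ℝ) :
    cdfM (empMeas x) t = (Finset.univ.filter fun i => (x i : ℝ) ≤ t).card / n := by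
  have hm : MeasurableSet {s : ↥(Set.Icc (0:ℝ) 1) | (s : ℝ) ≤ t} :=
    measurableSet_le measurable_subtype_coe measurable_const
  rw [cdfM, coe_empMeas hn, empMeasAux]
  simp only [Measure.smul_apply, Measure.coe_finsetSum, Finset.sum_apply, smul_eq_mul,
    Measure.dirac_apply' _ hm, Set.indicator_apply, Set.mem_ofPred_eq, Pi.one_apply,
    Finset.sum_boole, ENNReal.toReal_mul, ENNReal.toReal_inv, ENNReal.toReal_natCast]
  ring

lemma geninv_empMeas {n : ℕ} (x : Fin n → ↥(Set.Icc (0:ℝ) 1)) (k : Fin n) {u : ℝ}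
    (hu : u ∈ openCell n k) : geninv (empMeas x) u = x (Tuple.sort x k) := by
  have hn : 0 < n := k.pos
  have hn' : (0 : ℝ) < n := by exact_mod_cast hn
  have hset : {t | t ∈ Set.Icc (0:ℝ) 1 ∧ u < cdfM (empMeas x) t}
      = Set.Icc (x (Tuple.sort x k) : ℝ) 1 := by
    ext t
    rw [Set.mem_ofPred_eq, cdfM_empMeas hn, lt_div_iff₀ hn', Set.mem_Icc, Set.mem_Icc,
      ← card_filter_le_of_sort]
    set m := (Finset.univ.filter fun i => (x i : ℝ) ≤ t).card with hm
    have h1 : (k : ℝ) < u * n := (div_lt_iff₀ hn').1 hu.1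
    have h2 : u * n < k + 1 := (lt_div_iff₀ hn').1 hu.2
    have h3 : u * n < m ↔ (k : ℕ) < m := by
      constructor
      · intro h
        exact_mod_cast h1.trans h
      · intro h
        have : ((k : ℕ) + 1 : ℝ) ≤ m := by exact_mod_cast h
        linarith
    rw [h3]
    constructor
    · rintro ⟨⟨_, h⟩, h'⟩; exact ⟨h', h⟩
    · rintro ⟨h', h⟩
      refine ⟨⟨?_, h⟩, h'⟩
      rw [hm, card_filter_le_of_sort] at h'
      exact (x _).2.1.trans h'
  rw [geninv, hset, csInf_Icc (x _).2.2]

lemma inducedGraphon_empMeas (Hfun : ℝ → ℝ → M01 → ℝ) {n : ℕ} (x : Fin n → ↥(Set.Icc (0:ℝ) 1))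
    (k l : Fin n) {u v : ℝ} (hu : u ∈ openCell n k) (hv : v ∈ openCell n l) :
    inducedGraphon Hfun (empMeas x) u v
      = Hfun (x (Tuple.sort x k)) (x (Tuple.sort x l)) (empMeas x) := by
  rw [inducedGraphon, geninv_empMeas x k hu, geninv_empMeas x l hv]

open Classical in
/-- The indicator of the edge `ij`, centred by the edge probability. -/
noncomputable def centredEdge (Hfun : ℝ → ℝ → M01 → ℝ) {n : ℕ} (x : Fin n → ↥(Set.Icc (0:ℝ) 1))
    (u : Fin n × Fin n → ℝ) (i j : Fin n) : ℝ :=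
  (if irgtAdj Hfun x u i j then 1 else 0) - Hfun (x i) (x j) (empMeas x)

lemma cutMetric_irgt_le (Hfun : ℝ → ℝ → M01 → ℝ) {n : ℕ} (hn : 0 < n)
    (x : Fin n → ↥(Set.Icc (0:ℝ) 1)) (u : Fin n × Fin n → ℝ) (M : ℝ)
    (hM : ∀ S T : Finset (Fin n), |∑ i ∈ S, ∑ j ∈ T, centredEdge Hfun x u i j| ≤ M) :
    cutMetric (empGraphon (irgtAdj Hfun x u)) (inducedGraphon Hfun (empMeas x))
      ≤ M / (n : ℝ) ^ 2 := by
  set π := Tuple.sort x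
  refine (cutMetric_le_cutDist _ _ (cellMPBij hn π)).trans
    (cutDist_le_of_step hn _ _ (fun k l => centredEdge Hfun x u (π k) (π l)) M ?_ ?_)
  · intro k l a ha b hb
    rw [inducedGraphon_empMeas Hfun x k l ha hb]
    show empGraphon _ (cellPerm π a) (cellPerm π b) - _ = _
    rw [empGraphon_of_mem _ (cellPerm_mem_halfCell π (openCell_subset_halfCell _ ha))
      (cellPerm_mem_halfCell π (openCell_subset_halfCell _ hb))]
    rfl
  · intro S T
    simpa using hM (S.map π.toEmbedding) (T.map π.toEmbedding)

lemma exists_sum_ge_of_cutMetric_ge (Hfun : ℝ → ℝ → M01 → ℝ) {n : ℕ} (hn : 0 < n)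
    (x : Fin n → ↥(Set.Icc (0:ℝ) 1)) (u : Fin n × Fin n → ℝ) {ε : ℝ}
    (h : ε ≤ cutMetric (empGraphon (irgtAdj Hfun x u)) (inducedGraphon Hfun (empMeas x))) :
    ∃ S T : Finset (Fin n), ε * (n : ℝ) ^ 2 ≤ |∑ i ∈ S, ∑ j ∈ T, centredEdge Hfun x u i j| := by
  have hn' : (0 : ℝ) < n := by exact_mod_cast hn
  obtain ⟨⟨S, T⟩, hST⟩ := Finite.exists_max fun p : Finset (Fin n) × Finset (Fin n) =>
    |∑ i ∈ p.1, ∑ j ∈ p.2, centredEdge Hfun x u i j|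
  refine ⟨S, T, ?_⟩
  have := h.trans (cutMetric_irgt_le Hfun hn x u _ fun S' T' => hST (S', T'))
  rwa [le_div_iff₀ (by positivity)] at this

lemma continuous_empMeas {n : ℕ} (hn : 0 < n) :
    Continuous (empMeas : (Fin n → ↥(Set.Icc (0:ℝ) 1)) → M01) := by
  rw [continuous_iff_continuousAt]
  intro x₀
  rw [ContinuousAt, ProbabilityMeasure.tendsto_iff_forall_integral_tendsto]
  intro f
  have hint : ∀ x : Fin n → ↥(Set.Icc (0:ℝ) 1),
      ∫ a, f a ∂(empMeas x : Measure ↥(Set.Icc (0:ℝ) 1)) = (n : ℝ)⁻¹ * ∑ i, f (x i) := by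
    intro x
    rw [coe_empMeas hn, empMeasAux, integral_smul_measure,
      integral_finsetSum_measure fun i _ => integrable_dirac (by simp)]
    simp
  simp_rw [hint]
  have : Continuous fun x : Fin n → ↥(Set.Icc (0:ℝ) 1) => (n : ℝ)⁻¹ * ∑ i, f (x i) := by
    fun_prop
  exact this.tendsto x₀

lemma continuous_sorted_kernel (Hfun : ℝ → ℝ → M01 → ℝ)
    (hGraphon : ∀ F : M01, IsGraphon (inducedGraphon Hfun F))
    (hcont : ∀ F₀ : M01,
      Tendsto (fun F => L1dist (inducedGraphon Hfun F) (inducedGraphon Hfun F₀))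
        (nhds F₀) (nhds 0)) {n : ℕ} (k l : Fin n) :
    Continuous fun x : Fin n → ↥(Set.Icc (0:ℝ) 1) =>
      Hfun (x (Tuple.sort x k)) (x (Tuple.sort x l)) (empMeas x) := by
  have hn : 0 < n := k.pos
  have hn' : (0 : ℝ) < n := by exact_mod_cast hn
  rw [continuous_iff_continuousAt]
  intro x₀
  have hlim := ((hcont (empMeas x₀)).comp ((continuous_empMeas hn).tendsto x₀)).const_mul
    ((n : ℝ) ^ 2)
  rw [mul_zero] at hlim
  rw [ContinuousAt, tendsto_iff_dist_tendsto_zero]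
  refine squeeze_zero (fun _ => dist_nonneg) (fun x => ?_) hlim
  rw [Real.dist_eq]
  set δ := |Hfun (x (Tuple.sort x k)) (x (Tuple.sort x l)) (empMeas x)
    - Hfun (x₀ (Tuple.sort x₀ k)) (x₀ (Tuple.sort x₀ l)) (empMeas x₀)| with hδ
  set g := inducedGraphon Hfun (empMeas x)
  set g₀ := inducedGraphon Hfun (empMeas x₀)
  have hgm : Measurable fun p : ℝ × ℝ => |g p.1 p.2 - g₀ p.1 p.2| :=
    ((hGraphon (empMeas x)).1.sub (hGraphon (empMeas x₀)).1).abs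
  have hint : IntegrableOn (fun p : ℝ × ℝ => |g p.1 p.2 - g₀ p.1 p.2|) unitSq := by
    refine Measure.integrableOn_of_bounded (M := 1) ?_ hgm.aestronglyMeasurable ?_
    · rw [unitSq, Measure.volume_eq_prod, Measure.prod_prod]; simp
    · refine Eventually.of_forall fun p => ?_
      have h1 := (hGraphon (empMeas x)).2.2 p.1 p.2
      have h2 := (hGraphon (empMeas x₀)).2.2 p.1 p.2
      rw [Real.norm_eq_abs, abs_abs, abs_le]
      exact ⟨by linarith [h1.1, h2.2], by linarith [h1.2, h2.1]⟩
  have hsub : openCell n k ×ˢ openCell n l ⊆ unitSq := by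
    have : ∀ m : Fin n, openCell n m ⊆ Set.Icc 0 1 := fun m => by
      refine (openCell_subset_halfCell m).trans ?_
      refine (Set.subset_iUnion (halfCell n) m).trans ?_
      rw [iUnion_halfCell hn]
      exact Set.Ioc_subset_Icc_self
    exact Set.prod_mono (this k) (this l)
  have hcell : ∫ p in openCell n k ×ˢ openCell n l, |g p.1 p.2 - g₀ p.1 p.2|
      = δ / (n : ℝ) ^ 2 := by
    rw [setIntegral_congr_fun (g := fun _ => δ) 
      (show MeasurableSet (openCell n k ×ˢ openCell n l) from
        measurableSet_Ioo.prod measurableSet_Ioo)]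
    · have hv : ∀ m : Fin n, (volume (openCell n m)).toReal = 1 / n := fun m => by
        rw [openCell, ← measureReal_def, Real.volume_real_Ioo_of_le (by gcongr; linarith)]
        ring
      rw [setIntegral_const, measureReal_def, Measure.volume_eq_prod, Measure.prod_prod,
        ENNReal.toReal_mul, hv, hv, smul_eq_mul]
      field_simp
    · rintro ⟨a, b⟩ ⟨ha, hb⟩
      simp only [g, g₀, hδ]
      rw [inducedGraphon_empMeas Hfun x k l ha hb, inducedGraphon_empMeas Hfun x₀ k l ha hb]
  have hle := setIntegral_mono_set hint (Eventually.of_forall fun p => abs_nonneg _)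
    (LE.le.eventuallyLE hsub)
  rw [hcell, div_le_iff₀ (by positivity)] at hle
  rw [mul_comm]
  exact hle

lemma measurable_kernel_types (Hfun : ℝ → ℝ → M01 → ℝ)
    (hGraphon : ∀ F : M01, IsGraphon (inducedGraphon Hfun F))
    (hcont : ∀ F₀ : M01,
      Tendsto (fun F => L1dist (inducedGraphon Hfun F) (inducedGraphon Hfun F₀))
        (nhds F₀) (nhds 0)) {n : ℕ} (i j : Fin n) :
    Measurable fun x : Fin n → ↥(Set.Icc (0:ℝ) 1) => Hfun (x i) (x j) (empMeas x) := by
  let _ : MeasurableSpace (Equiv.Perm (Fin n)) := ⊤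
  have hsort : Measurable fun x : Fin n → ↥(Set.Icc (0:ℝ) 1) => Tuple.sort x := by
    refine measurable_to_countable' fun π => ?_
    have : (fun x : Fin n → ↥(Set.Icc (0:ℝ) 1) => Tuple.sort x) ⁻¹' {π}
        = {x | (∀ a b, a ≤ b → x (π a) ≤ x (π b)) ∧
            ∀ a b, a < b → x (π a) = x (π b) → π a < π b} := by
      ext x
      rw [Set.mem_preimage, Set.mem_singleton_iff, eq_comm, Tuple.eq_sort_iff]
      rfl
    rw [this]
    simp only [Set.ofPred_and, Set.ofPred_forall]
    refine MeasurableSet.inter ?_ ?_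
    · refine .iInter fun a => .iInter fun b => .iInter fun _ => ?_
      exact measurableSet_le (measurable_pi_apply _) (measurable_pi_apply _)
    · refine .iInter fun a => .iInter fun b => .iInter fun _ => ?_
      have := measurableSet_eq_fun (measurable_pi_apply (X := fun _ => ↥(Set.Icc (0:ℝ) 1)) (π a))
        (measurable_pi_apply (π b))
      exact this.imp (.const _)
  have hW : Measurable fun p : (Fin n → ↥(Set.Icc (0:ℝ) 1)) × Equiv.Perm (Fin n) =>
      Hfun (p.1 (Tuple.sort p.1 (p.2.symm i))) (p.1 (Tuple.sort p.1 (p.2.symm j)))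
        (empMeas p.1) :=
    measurable_from_prod_countable_left fun π =>
      (continuous_sorted_kernel Hfun hGraphon hcont (π.symm i) (π.symm j)).measurable
  simpa [Function.comp_def] using hW.comp (measurable_id.prodMk hsort)

instance : IsProbabilityMeasure (volume.restrict (Set.Icc (0:ℝ) 1)) := ⟨by simp⟩

instance (n : ℕ) : IsProbabilityMeasure (cubeMeasure n) := by
  unfold cubeMeasure; infer_instance

section Hoeffding

open ProbabilityTheory

open Classical in
lemma integral_threshold {w : ℝ} (hw : w ∈ Set.Icc (0:ℝ) 1) :
    ∫ v in Set.Icc (0:ℝ) 1, (if v ≤ w then (1 : ℝ) else 0) = w := by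
  have h : (fun v : ℝ => if v ≤ w then (1 : ℝ) else 0) = (Set.Iic w).indicator 1 := by
    ext v; simp [Set.indicator_apply]
  rw [h, integral_indicator_one measurableSet_Iic, measureReal_restrict_apply measurableSet_Iic,
    show Set.Iic w ∩ Set.Icc 0 1 = Set.Icc 0 w by
      ext v; simp only [Set.mem_inter_iff, Set.mem_Iic, Set.mem_Icc]
      exact ⟨fun h => ⟨h.2.1, h.1⟩, fun h => ⟨h.2, h.1, h.2.trans hw.2⟩⟩,
    Real.volume_real_Icc_of_le hw.1, sub_zero]

open Classical in
lemma hasSubgaussianMGF_threshold {c w : ℝ} (hc : c ∈ Set.Icc (0:ℝ) 2)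
    (hw : w ∈ Set.Icc (0:ℝ) 1) :
    HasSubgaussianMGF (fun v : ℝ => c * ((if v ≤ w then 1 else 0) - w)) 1
      (volume.restrict (Set.Icc 0 1)) := by
  have hm : Measurable fun v : ℝ => if v ≤ w then (1 : ℝ) else 0 :=
    Measurable.ite measurableSet_Iic measurable_const measurable_const
  have h := hasSubgaussianMGF_of_mem_Icc_of_integral_eq_zero
    (μ := volume.restrict (Set.Icc (0:ℝ) 1)) (a := -2 * w) (b := 2 * (1 - w))
    (X := fun v : ℝ => c * ((if v ≤ w then 1 else 0) - w))
    ((hm.sub_const w).const_mul c).aemeasurable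
    (Eventually.of_forall fun v => by
      obtain ⟨hc0, hc2⟩ := hc
      obtain ⟨hw0, hw1⟩ := hw
      split_ifs
      · constructor <;> nlinarith
      · constructor <;> nlinarith)
    (by
      have hi : Integrable (fun v : ℝ => if v ≤ w then (1 : ℝ) else 0)
          (volume.restrict (Set.Icc (0:ℝ) 1)) :=
        Integrable.of_bound hm.aestronglyMeasurable 1
          (Eventually.of_forall fun v => by split_ifs <;> simp)
      rw [integral_const_mul, integral_sub hi (integrable_const _), integral_threshold hw]
      simp)
  have he : ((‖2 * (1 - w) - -2 * w‖₊ / 2) ^ 2 : NNReal) = 1 := by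
    rw [show 2 * (1 - w) - -2 * w = 2 by ring]
    simp
  rwa [he] at h

open Classical in
lemma measure_abs_sum_threshold_ge_le {ι : Type*} [Fintype ι] (c w : ι → ℝ)
    (hc : ∀ p, c p ∈ Set.Icc (0:ℝ) 2) (hw : ∀ p, w p ∈ Set.Icc (0:ℝ) 1) {t : ℝ} (ht : 0 ≤ t) :
    (Measure.pi fun _ : ι => volume.restrict (Set.Icc (0:ℝ) 1))
        {u | t ≤ |∑ p, c p * ((if u p ≤ w p then 1 else 0) - w p)|}
      ≤ ENNReal.ofReal (2 * Real.exp (-t ^ 2 / (2 * Fintype.card ι))) := by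
  set μ := Measure.pi fun _ : ι => volume.restrict (Set.Icc (0:ℝ) 1)
  set φ : ι → ℝ → ℝ := fun p v => c p * ((if v ≤ w p then 1 else 0) - w p)
  have hφ : ∀ p, Measurable (φ p) := fun p =>
    ((Measurable.ite measurableSet_Iic measurable_const measurable_const).sub_const _).const_mul _
  have hind : iIndepFun (fun p (u : ι → ℝ) => φ p (u p)) μ :=
    iIndepFun_pi fun p => (hφ p).aemeasurable
  have hsub : ∀ p, HasSubgaussianMGF (fun u : ι → ℝ => φ p (u p)) 1 μ := by
    intro p
    refine HasSubgaussianMGF.of_map (X := φ p) (Y := fun u : ι → ℝ => u p)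
      (measurable_pi_apply p).aemeasurable ?_
    have h : μ.map (fun u : ι → ℝ => u p) = volume.restrict (Set.Icc 0 1) :=
      (measurePreserving_eval (fun _ : ι => volume.restrict (Set.Icc (0:ℝ) 1)) p).map_eq
    rw [h]
    exact hasSubgaussianMGF_threshold (hc p) (hw p)
  have hsum := HasSubgaussianMGF.sum_of_iIndepFun (s := Finset.univ) hind (c := fun _ => 1)
    fun p _ => hsub p
  have h1 := hsum.measure_ge_le ht
  have h2 := hsum.neg.measure_ge_le ht
  simp only [Finset.sum_const, Finset.card_univ, nsmul_eq_mul, mul_one, NNReal.coe_natCast]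
    at h1 h2
  rw [ENNReal.le_ofReal_iff_toReal_le (measure_ne_top _ _) (by positivity), ← measureReal_def,
    two_mul (Real.exp _)]
  refine le_trans ?_ (add_le_add h1 h2)
  refine le_trans (measureReal_mono ?_) (measureReal_union_le _ _)
  intro u hu
  have hu' : t ≤ |∑ p, φ p (u p)| := hu
  exact (le_abs.1 hu').imp id fun h => by simpa using h

end Hoeffding

lemma centredEdge_comm (Hfun : ℝ → ℝ → M01 → ℝ) (Hsymm : ∀ a b F, Hfun a b F = Hfun b a F) {n : ℕ}
    (x : Fin n → ↥(Set.Icc (0:ℝ) 1)) (u : Fin n × Fin n → ℝ) (i j : Fin n) :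
    centredEdge Hfun x u i j = centredEdge Hfun x u j i := by
  have h : irgtAdj Hfun x u i j = irgtAdj Hfun x u j i := by
    simp only [irgtAdj, ne_comm (a := i), min_comm i, max_comm i, Hsymm (x i) (x j)]
  rw [centredEdge, centredEdge, h, Hsymm (x i) (x j)]

lemma centredEdge_self (Hfun : ℝ → ℝ → M01 → ℝ) {n : ℕ}
    (x : Fin n → ↥(Set.Icc (0:ℝ) 1)) (u : Fin n × Fin n → ℝ) (i : Fin n) :
    centredEdge Hfun x u i i = -Hfun (x i) (x i) (empMeas x) := by
  simp [centredEdge, irgtAdj]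

open Classical in
lemma centredEdge_of_lt (Hfun : ℝ → ℝ → M01 → ℝ) {n : ℕ}
    (x : Fin n → ↥(Set.Icc (0:ℝ) 1)) (u : Fin n × Fin n → ℝ) {i j : Fin n} (h : i < j) :
    centredEdge Hfun x u i j = (if u (i, j) ≤ Hfun (x i) (x j) (empMeas x) then 1 else 0)
      - Hfun (x i) (x j) (empMeas x) := by
  simp [centredEdge, irgtAdj, h.ne, h.le]

lemma sum_eq_sum_lt_add_diag {ι : Type*} [Fintype ι] [LinearOrder ι] (a : ι → ι → ℝ) :
    ∑ i, ∑ j, a i j = (∑ p : ι × ι, if p.1 < p.2 then a p.1 p.2 + a p.2 p.1 else 0)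
      + ∑ i, a i i := by
  have h1 : ∀ i j, a i j = (if i < j then a i j else 0) + (if j < i then a i j else 0)
      + (if i = j then a i j else 0) := by
    intro i j
    rcases lt_trichotomy i j with h | h | h
    · simp [h, h.ne, h.not_gt]
    · simp [h]
    · simp [h, h.ne', h.not_gt]
  have h2 : ∑ i, ∑ j, (if j < i then a i j else 0) = ∑ i, ∑ j, (if i < j then a j i else 0) :=
    Finset.sum_comm
  calc ∑ i, ∑ j, a i j
      = ∑ i, ∑ j, ((if i < j then a i j else 0) + (if j < i then a i j else 0)
          + (if i = j then a i j else 0)) :=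
        Finset.sum_congr rfl fun i _ => Finset.sum_congr rfl fun j _ => h1 i j
    _ = _ := by
        simp only [Finset.sum_add_distrib, h2, Finset.sum_ite_eq, Finset.mem_univ, if_true]
        rw [Fintype.sum_prod_type, ← Finset.sum_add_distrib]
        congr 1
        refine Finset.sum_congr rfl fun i _ => ?_
        rw [← Finset.sum_add_distrib]
        refine Finset.sum_congr rfl fun j _ => ?_
        split_ifs <;> simp

open Classical in
lemma measure_sum_centredEdge_ge_le (Hfun : ℝ → ℝ → M01 → ℝ)
    (Hsymm : ∀ a b F, Hfun a b F = Hfun b a F)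
    (Hrange : ∀ a b F, Hfun a b F ∈ Set.Icc (0:ℝ) 1) {n : ℕ}
    (x : Fin n → ↥(Set.Icc (0:ℝ) 1)) (S T : Finset (Fin n)) {r : ℝ} (hr : (n : ℝ) ≤ r) :
    cubeMeasure n {u | r ≤ |∑ i ∈ S, ∑ j ∈ T, centredEdge Hfun x u i j|}
      ≤ ENNReal.ofReal (2 * Real.exp (-(r - n) ^ 2 / (2 * (n : ℝ) ^ 2))) := by
  set s : Fin n → ℝ := fun i => if i ∈ S then 1 else 0 with hs
  set t : Fin n → ℝ := fun i => if i ∈ T then 1 else 0 with ht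
  have hs01 : ∀ i, s i ∈ Set.Icc (0:ℝ) 1 := fun i => by simp only [hs]; split_ifs <;> simp
  have ht01 : ∀ i, t i ∈ Set.Icc (0:ℝ) 1 := fun i => by simp only [ht]; split_ifs <;> simp
  set c : Fin n × Fin n → ℝ :=
    fun p => if p.1 < p.2 then s p.1 * t p.2 + s p.2 * t p.1 else 0 with hcdef
  set w : Fin n × Fin n → ℝ := fun p => Hfun (x p.1) (x p.2) (empMeas x)
  have hst : ∀ i j, s i * t j ∈ Set.Icc (0:ℝ) 1 := fun i j =>
    ⟨mul_nonneg (hs01 i).1 (ht01 j).1, mul_le_one₀ (hs01 i).2 (ht01 j).1 (ht01 j).2⟩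
  have hc : ∀ p, c p ∈ Set.Icc (0:ℝ) 2 := fun p => by
    have h1 := hst p.1 p.2
    have h2 := hst p.2 p.1
    simp only [hcdef]
    split_ifs
    · exact ⟨by linarith [h1.1, h2.1], by linarith [h1.2, h2.2]⟩
    · simp
  have hsum : ∀ u, ∑ i ∈ S, ∑ j ∈ T, centredEdge Hfun x u i j
      = (∑ p, c p * ((if u p ≤ w p then 1 else 0) - w p)) - ∑ i, s i * t i * w (i, i) := by
    intro u
    have h1 : ∑ i ∈ S, ∑ j ∈ T, centredEdge Hfun x u i j
        = ∑ i, ∑ j, s i * t j * centredEdge Hfun x u i j := by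
      simp only [hs, ht, ite_mul, one_mul, zero_mul, Finset.sum_ite_mem, Finset.univ_inter,
        Finset.sum_ite_irrel, Finset.sum_const_zero]
    rw [h1, sum_eq_sum_lt_add_diag, sub_eq_add_neg, ← Finset.sum_neg_distrib]
    congr 1
    · refine Finset.sum_congr rfl fun p _ => ?_
      simp only [hcdef]
      by_cases h : p.1 < p.2
      · rw [if_pos h, if_pos h, centredEdge_comm Hfun Hsymm x u p.2 p.1,
          centredEdge_of_lt Hfun x u h]
        ring
      · rw [if_neg h, if_neg h, zero_mul]
    · refine Finset.sum_congr rfl fun i _ => ?_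
      rw [centredEdge_self, mul_neg]
  have hdiag : |∑ i, s i * t i * w (i, i)| ≤ n := by
    refine (Finset.abs_sum_le_sum_abs _ _).trans ?_
    refine (Finset.sum_le_sum (g := fun _ => (1 : ℝ)) fun i _ => ?_).trans (by simp)
    have hw := Hrange (x i) (x i) (empMeas x)
    rw [abs_of_nonneg (mul_nonneg (hst i i).1 hw.1)]
    exact mul_le_one₀ (hst i i).2 hw.1 hw.2
  have key := measure_abs_sum_threshold_ge_le c w hc (fun p => Hrange _ _ _)
    (sub_nonneg.2 hr)
  have hcard : (Fintype.card (Fin n × Fin n) : ℝ) = (n : ℝ) ^ 2 := by simp [sq]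
  rw [hcard] at key
  refine (measure_mono fun u hu => ?_).trans key
  have hu' : r ≤ |∑ i ∈ S, ∑ j ∈ T, centredEdge Hfun x u i j| := hu
  rw [hsum] at hu'
  show r - n ≤ |_|
  have := abs_sub (∑ p, c p * ((if u p ≤ w p then 1 else 0) - w p)) (∑ i, s i * t i * w (i, i))
  linarith

lemma measurable_centredEdge (Hfun : ℝ → ℝ → M01 → ℝ)
    (hGraphon : ∀ F : M01, IsGraphon (inducedGraphon Hfun F))
    (hcont : ∀ F₀ : M01,
      Tendsto (fun F => L1dist (inducedGraphon Hfun F) (inducedGraphon Hfun F₀))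
        (nhds F₀) (nhds 0)) {n : ℕ} (i j : Fin n) :
    Measurable fun ω : (Fin n → ↥(Set.Icc (0:ℝ) 1)) × (Fin n × Fin n → ℝ) =>
      centredEdge Hfun ω.1 ω.2 i j := by
  have hH : Measurable fun ω : (Fin n → ↥(Set.Icc (0:ℝ) 1)) × (Fin n × Fin n → ℝ) =>
      Hfun (ω.1 i) (ω.1 j) (empMeas ω.1) :=
    (measurable_kernel_types Hfun hGraphon hcont i j).comp measurable_fst
  refine Measurable.sub (Measurable.ite ?_ measurable_const measurable_const) hH
  refine (MeasurableSet.const _).inter (measurableSet_le ?_ hH)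
  exact (measurable_pi_apply _).comp measurable_snd

lemma measure_cutMetric_irgt_ge_le (Hfun : ℝ → ℝ → M01 → ℝ)
    (Hsymm : ∀ a b F, Hfun a b F = Hfun b a F)
    (Hrange : ∀ a b F, Hfun a b F ∈ Set.Icc (0:ℝ) 1)
    (hGraphon : ∀ F : M01, IsGraphon (inducedGraphon Hfun F))
    (hcont : ∀ F₀ : M01,
      Tendsto (fun F => L1dist (inducedGraphon Hfun F) (inducedGraphon Hfun F₀))
        (nhds F₀) (nhds 0))
    {n : ℕ} (hn : 0 < n) (ν : Measure (Fin n → ↥(Set.Icc (0:ℝ) 1))) [IsProbabilityMeasure ν]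
    {ε : ℝ} (hεn : 1 ≤ ε * n) :
    (ν.prod (cubeMeasure n))
        {ω | ε ≤ cutMetric (empGraphon (irgtAdj Hfun ω.1 ω.2))
                  (inducedGraphon Hfun (empMeas ω.1))}
      ≤ ENNReal.ofReal (4 ^ n * (2 * Real.exp (-(ε * n - 1) ^ 2 / 2))) := by
  have hn' : (0 : ℝ) < n := by exact_mod_cast hn
  set B := 2 * Real.exp (-(ε * n - 1) ^ 2 / 2) with hB
  set E : Finset (Fin n) × Finset (Fin n) →
      Set ((Fin n → ↥(Set.Icc (0:ℝ) 1)) × (Fin n × Fin n → ℝ)) :=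
    fun P => {ω | ε * (n : ℝ) ^ 2 ≤ |∑ i ∈ P.1, ∑ j ∈ P.2, centredEdge Hfun ω.1 ω.2 i j|}
  have hE : ∀ P, (ν.prod (cubeMeasure n)) (E P) ≤ ENNReal.ofReal B := by
    intro P
    have hm : MeasurableSet (E P) := measurableSet_le measurable_const
      (Finset.measurable_sum _ fun i _ => Finset.measurable_sum _ fun j _ =>
        measurable_centredEdge Hfun hGraphon hcont i j).abs
    rw [Measure.prod_apply hm]
    calc ∫⁻ x, cubeMeasure n (Prod.mk x ⁻¹' E P) ∂ν ≤ ∫⁻ _, ENNReal.ofReal B ∂ν := by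
          refine lintegral_mono fun x => ?_
          have h := measure_sum_centredEdge_ge_le Hfun Hsymm Hrange x P.1 P.2
            (r := ε * (n : ℝ) ^ 2) (by nlinarith)
          have he : -(ε * (n : ℝ) ^ 2 - n) ^ 2 / (2 * (n : ℝ) ^ 2) = -(ε * n - 1) ^ 2 / 2 := by
            field_simp
          rwa [he] at h
      _ = ENNReal.ofReal B := by simp
  calc _ ≤ (ν.prod (cubeMeasure n)) (⋃ P, E P) := by
        refine measure_mono fun ω hω => ?_
        obtain ⟨S, T, h⟩ := exists_sum_ge_of_cutMetric_ge Hfun hn ω.1 ω.2 hω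
        exact Set.mem_iUnion.2 ⟨(S, T), h⟩
    _ ≤ ∑ P, (ν.prod (cubeMeasure n)) (E P) := measure_iUnion_fintype_le _ _
    _ ≤ ∑ _P : Finset (Fin n) × Finset (Fin n), ENNReal.ofReal B :=
        Finset.sum_le_sum fun P _ => hE P
    _ = ENNReal.ofReal (4 ^ n * B) := by
        clear_value B
        rw [ENNReal.ofReal_mul (by positivity)]
        simp only [Finset.sum_const, Finset.card_univ, Fintype.card_prod, Fintype.card_finset,
          Fintype.card_fin, nsmul_eq_mul, ← mul_pow]
        norm_num

lemma tendsto_log_tail_div_binom2 (ε : ℝ) :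
    Tendsto (fun n : ℕ => (binom2 n)⁻¹ *
      (n * Real.log 4 + Real.log 2 + -(ε * n - 1) ^ 2 / 2)) atTop (nhds (-(ε ^ 2))) := by
  have hinv : Tendsto (fun n : ℕ => ((n : ℝ))⁻¹) atTop (nhds 0) :=
    tendsto_inv_atTop_nhds_zero_nat
  have hnum : Tendsto (fun n : ℕ => 2 * ((n : ℝ)⁻¹ * Real.log 4 + (n : ℝ)⁻¹ ^ 2 * Real.log 2
      + -(ε - (n : ℝ)⁻¹) ^ 2 / 2) / (1 - (n : ℝ)⁻¹)) atTop
      (nhds (2 * (0 * Real.log 4 + 0 ^ 2 * Real.log 2 + -(ε - 0) ^ 2 / 2) / (1 - 0))) := by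
    refine Tendsto.div (Tendsto.const_mul _ ?_) (tendsto_const_nhds.sub hinv) (by norm_num)
    refine ((hinv.mul_const _).add ((hinv.pow 2).mul_const _)).add ?_
    exact (((tendsto_const_nhds.sub hinv).pow 2).neg).div_const 2
  have hval : 2 * (0 * Real.log 4 + 0 ^ 2 * Real.log 2 + -(ε - 0) ^ 2 / 2) / (1 - 0)
      = -(ε ^ 2) := by ring
  rw [hval] at hnum
  refine hnum.congr' ?_
  filter_upwards [eventually_gt_atTop 1] with n hn
  have h0 : (n : ℝ) ≠ 0 := by positivity
  have h1 : (n : ℝ) - 1 ≠ 0 := by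
    have : (1 : ℝ) < n := by exact_mod_cast hn
    linarith
  unfold binom2
  field_simp

/-- **Lemma 5.3** (concentration for IRGTs around the induced reference graphon).
If `F ↦ g^{[F]}` is continuous from `M([0,1])` (weak topology) to `(W, ‖·‖_{L¹})`, then for
every `ε > 0`, `limsup (1/(n(n-1)/2)) log P(δ_□(h^{G_n}, g^{[F_n]}) ≥ ε) ≤ −ε²`. -/
theorem statement6
    (Hfun : ℝ → ℝ → M01 → ℝ)
    (Hsymm : ∀ a b F, Hfun a b F = Hfun b a F)
    (Hrange : ∀ a b F, Hfun a b F ∈ Set.Icc (0:ℝ) 1)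
    (hGraphon : ∀ F : M01, IsGraphon (inducedGraphon Hfun F))
    (ν : ∀ n : ℕ, Measure (Fin n → ↥(Set.Icc (0:ℝ) 1)))
    [∀ n, IsProbabilityMeasure (ν n)]
    (hcont : ∀ F₀ : M01,
      Tendsto (fun F => L1dist (inducedGraphon Hfun F) (inducedGraphon Hfun F₀))
        (nhds F₀) (nhds 0))
    (ε : ℝ) (hε : 0 < ε) :
    atTop.limsup (fun n => (((binom2 n)⁻¹ : ℝ) : EReal) *
        ENNReal.log (((ν n).prod (cubeMeasure n))
          {ω | ε ≤ cutMetric (empGraphon (irgtAdj Hfun ω.1 ω.2))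
                  (inducedGraphon Hfun (empMeas ω.1))}))
      ≤ ((-(ε ^ 2) : ℝ) : EReal) := by
  refine (limsup_le_limsup ?_).trans_eq
    ((continuous_coe_real_ereal.tendsto _).comp (tendsto_log_tail_div_binom2 ε)).limsup_eq
  filter_upwards [eventually_gt_atTop 1,
    tendsto_natCast_atTop_atTop.eventually_ge_atTop (1 / ε)] with n hn hnε
  have h := measure_cutMetric_irgt_ge_le Hfun Hsymm Hrange hGraphon hcont (by omega : 0 < n)
    (ν n) (ε := ε) (by rwa [div_le_iff₀ hε, mul_comm] at hnε)
  have hb : 0 ≤ (binom2 n)⁻¹ := by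
    have : (1 : ℝ) < n := by exact_mod_cast hn
    unfold binom2
    exact inv_nonneg.2 (div_nonneg (mul_nonneg (by linarith) (by linarith)) (by norm_num))
  have hlog : Real.log (4 ^ n * (2 * Real.exp (-(ε * n - 1) ^ 2 / 2)))
      = n * Real.log 4 + Real.log 2 + -(ε * n - 1) ^ 2 / 2 := by
    rw [Real.log_mul (by positivity) (by positivity), Real.log_mul (by norm_num) (by positivity),
      Real.log_pow, Real.log_exp, add_assoc]
  calc _ ≤ (((binom2 n)⁻¹ : ℝ) : EReal) * ENNReal.log (ENNReal.ofReal
        (4 ^ n * (2 * Real.exp (-(ε * n - 1) ^ 2 / 2)))) :=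
        mul_le_mul_of_nonneg_left (ENNReal.log_monotone h) (by exact_mod_cast hb)
    _ = _ := by
        rw [ENNReal.log_ofReal_of_pos (by positivity), hlog]
        rfl
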